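/- arXiv:1605.00589 — 2 statements merged into one kernel-verified Lean document; each statement's English description precedes it below -/
import Mathlib

section
/- Ratio bound for partition functions (Lemma 12.2). Let d ≥ 2, ℓ > 0, N ∈ ℕ, and let ε > 0 satisfy the Boltzmann–Grad scaling N ε^{d−1} = ℓ^{−1}. Let f_0 be a probability density on ℝ^d × ℝ^d with M := ‖f_0‖_{L^∞_x L^1_v} < ∞, and assume ℓ^{−1} |B_1^d| M ε < 1. Then for every 1 ≤ s < N: 1 ≤ 𝒵_N^{−1} 𝒵_{N−s} ≤ ( 1 − ℓ^{−1} |B_1^d| M ε )^{−s}, where |B_1^d| is the Lebesgue measure of the unit ball in ℝ^d. -/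
noncomputable section
open MeasureTheory
open scoped BigOperators

/-- Euclidean space `ℝ^d`. -/
abbrev Rd (d : ℕ) := EuclideanSpace ℝ (Fin d)

/-- The `s`-particle hard-sphere phase space `D_s`: all pairwise distances exceed `ε`. -/
def Dset (d s : ℕ) (ε : ℝ) : Set (Fin s → Rd d × Rd d) :=
  {Z | ∀ i j : Fin s, i < j → ε < dist (Z i).1 (Z j).1}

/-- The partition function `𝒵_s = ∫ 1_{Z_s ∈ D_s} ∏ f₀(z_i) dZ_s`. -/
def partitionFunction (d s : ℕ) (ε : ℝ) (f₀ : Rd d × Rd d → ℝ) : ℝ :=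
  ∫ Z in Dset d s ε, ∏ i, f₀ (Z i)

/-- The volume of the unit ball in `ℝ^d`. -/
def unitBallVol (d : ℕ) : ℝ := (volume (Metric.ball (0 : Rd d) 1)).toReal

/-- The conditioned tensorized `N`-particle density
`f_N(0,Z_N) = 𝒵_N⁻¹ 1_{Z_N ∈ D_N} ∏ f₀(z_i)`. -/
def conditionedData (d N : ℕ) (ε : ℝ) (f₀ : Rd d × Rd d → ℝ)
    (Z : Fin N → Rd d × Rd d) : ℝ :=
  (partitionFunction d N ε f₀)⁻¹ *
    Set.indicator (Dset d N ε) (fun W => ∏ i, f₀ (W i)) Z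

/-- The `s`-particle marginal of an `N`-particle function. -/
def marginal (d N s : ℕ) (hsN : s ≤ N) (F : (Fin N → Rd d × Rd d) → ℝ)
    (Z : Fin s → Rd d × Rd d) : ℝ :=
  ∫ W : Fin (N - s) → Rd d × Rd d,
    F (Fin.append Z W ∘ Fin.cast (Nat.add_sub_cancel' hsN).symm)

/-- The position-constrained mass of `f₀` in a ball of radius `ε` is at most `M |B_1| ε^d`. -/
theorem setIntegral_dist_fst_le (d : ℕ) (ε M : ℝ) (hε : 0 < ε)
    (f₀ : Rd d × Rd d → ℝ) (hint : Integrable f₀)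
    (hM : ∀ᵐ x : Rd d, (∫ v : Rd d, f₀ (x, v)) ≤ M) (y : Rd d) :
    ∫ z in {z : Rd d × Rd d | dist z.1 y ≤ ε}, f₀ z ≤ unitBallVol d * M * ε ^ d := by
  have hset : {z : Rd d × Rd d | dist z.1 y ≤ ε} = Metric.closedBall y ε ×ˢ Set.univ := by
    ext z; simp
  have hint' : Integrable f₀ ((volume : Measure (Rd d)).prod volume) := hint
  have hfin : volume (Metric.closedBall y ε) ≠ ⊤ := measure_closedBall_lt_top.ne
  rw [hset, Measure.volume_eq_prod, setIntegral_prod _ hint'.integrableOn]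
  simp only [Measure.restrict_univ]
  calc ∫ x in Metric.closedBall y ε, ∫ v, f₀ (x, v)
      ≤ ∫ _ in Metric.closedBall y ε, M := by
        refine integral_mono_ae hint'.integral_prod_left.integrableOn ?_
          (ae_restrict_of_ae hM)
        exact integrableOn_const hfin
    _ = unitBallVol d * M * ε ^ d := by
        rw [setIntegral_const, smul_eq_mul, Measure.addHaar_real_closedBall _ _ hε.le]
        simp only [finrank_euclideanSpace, Fintype.card_fin, unitBallVol, Measure.real]
        ring

theorem measurableSet_setOf_forall_lt_dist_fst (d k : ℕ) (ε : ℝ) (Z : Fin k → Rd d × Rd d) :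
    MeasurableSet {z : Rd d × Rd d | ∀ i, ε < dist z.1 (Z i).1} := by
  rw [Set.ofPred_forall]
  exact MeasurableSet.iInter fun i =>
    measurableSet_lt measurable_const (measurable_fst.dist measurable_const)

theorem measurableSet_Dset (d k : ℕ) (ε : ℝ) : MeasurableSet (Dset d k ε) := by
  simp only [Dset, Set.ofPred_forall]
  refine MeasurableSet.iInter fun i => MeasurableSet.iInter fun j => MeasurableSet.iInter fun _ =>
    measurableSet_lt measurable_const ?_
  exact (measurable_pi_apply i).fst.dist (measurable_pi_apply j).fst

/-- The mass available to a particle excluded from the `ε`-balls around `k` given particles. -/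
theorem one_sub_le_setIntegral_forall_lt_dist (d k : ℕ) (ε M : ℝ) (hε : 0 < ε)
    (f₀ : Rd d × Rd d → ℝ) (hnn : ∀ z, 0 ≤ f₀ z)
    (hint : Integrable f₀) (hmass : ∫ z, f₀ z = 1)
    (hM : ∀ᵐ x : Rd d, (∫ v : Rd d, f₀ (x, v)) ≤ M) (Z : Fin k → Rd d × Rd d) :
    1 - k * (unitBallVol d * M * ε ^ d) ≤
      ∫ z in {z : Rd d × Rd d | ∀ i, ε < dist z.1 (Z i).1}, f₀ z := by
  have hA (i : Fin k) : MeasurableSet {z : Rd d × Rd d | dist z.1 (Z i).1 ≤ ε} :=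
    measurableSet_le (measurable_fst.dist measurable_const) measurable_const
  have hS := measurableSet_setOf_forall_lt_dist_fst d k ε Z
  have hsum : Integrable fun z =>
      ∑ i : Fin k, {z : Rd d × Rd d | dist z.1 (Z i).1 ≤ ε}.indicator f₀ z :=
    integrable_finsetSum _ fun i _ => hint.indicator (hA i)
  calc 1 - k * (unitBallVol d * M * ε ^ d)
      ≤ 1 - ∑ i : Fin k, ∫ z in {z : Rd d × Rd d | dist z.1 (Z i).1 ≤ ε}, f₀ z := by
        have := Finset.sum_le_sum fun (i : Fin k) (_ : i ∈ Finset.univ) =>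
          setIntegral_dist_fst_le d ε M hε f₀ hint hM (Z i).1
        simp only [Finset.sum_const, Finset.card_univ, Fintype.card_fin, nsmul_eq_mul] at this
        linarith
    _ = ∫ z, (f₀ z - ∑ i : Fin k, {z : Rd d × Rd d | dist z.1 (Z i).1 ≤ ε}.indicator f₀ z) := by
        rw [integral_sub hint hsum, hmass, integral_finsetSum _ fun i _ => hint.indicator (hA i)]
        simp only [integral_indicator (hA _)]
    _ ≤ ∫ z, {z : Rd d × Rd d | ∀ i, ε < dist z.1 (Z i).1}.indicator f₀ z := by
        refine integral_mono (hint.sub hsum) (hint.indicator hS) fun z => ?_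
        have hterm (i : Fin k) :
            0 ≤ {z : Rd d × Rd d | dist z.1 (Z i).1 ≤ ε}.indicator f₀ z :=
          Set.indicator_nonneg (fun z _ => hnn z) z
        by_cases hz : ∀ i, ε < dist z.1 (Z i).1
        · rw [Set.indicator_of_mem (show z ∈ {z : Rd d × Rd d | ∀ i, ε < dist z.1 (Z i).1} from hz)]
          exact sub_le_self _ (Finset.sum_nonneg fun i _ => hterm i)
        · rw [Set.indicator_of_notMem
            (show z ∉ {z : Rd d × Rd d | ∀ i, ε < dist z.1 (Z i).1} from hz)]
          push Not at hz
          obtain ⟨i, hi⟩ := hz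
          have := Finset.single_le_sum (fun i _ => hterm i) (Finset.mem_univ i)
          rw [Set.indicator_of_mem (show z ∈ {z : Rd d × Rd d | dist z.1 (Z i).1 ≤ ε} from hi)]
            at this
          exact sub_nonpos.2 this
    _ = _ := integral_indicator hS

theorem cons_mem_Dset_iff (d k : ℕ) (ε : ℝ) (z : Rd d × Rd d) (Z : Fin k → Rd d × Rd d) :
    (Fin.cons z Z : Fin (k + 1) → Rd d × Rd d) ∈ Dset d (k + 1) ε ↔
      Z ∈ Dset d k ε ∧ ∀ i, ε < dist z.1 (Z i).1 := by
  simp [Dset, Fin.forall_fin_succ, and_comm]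

/-- Comparison of consecutive partition functions. -/
theorem partitionFunction_succ_bounds (d k : ℕ) (ε M : ℝ) (hε : 0 < ε)
    (f₀ : Rd d × Rd d → ℝ) (hnn : ∀ z, 0 ≤ f₀ z)
    (hint : Integrable f₀) (hmass : ∫ z, f₀ z = 1)
    (hM : ∀ᵐ x : Rd d, (∫ v : Rd d, f₀ (x, v)) ≤ M) :
    (1 - k * (unitBallVol d * M * ε ^ d)) * partitionFunction d k ε f₀ ≤
        partitionFunction d (k + 1) ε f₀ ∧
      partitionFunction d (k + 1) ε f₀ ≤ partitionFunction d k ε f₀ := by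
  let G (n : ℕ) (Z : Fin n → Rd d × Rd d) : ℝ :=
    (Dset d n ε).indicator (fun W => ∏ i, f₀ (W i)) Z
  let h (Z : Fin k → Rd d × Rd d) : ℝ :=
    ∫ z in {z : Rd d × Rd d | ∀ i, ε < dist z.1 (Z i).1}, f₀ z
  have hG (n : ℕ) : partitionFunction d n ε f₀ = ∫ Z, G n Z :=
    (integral_indicator (measurableSet_Dset d n ε)).symm
  have hGint (n : ℕ) : Integrable (G n) :=
    (Integrable.fintype_prod fun _ => hint).indicator (measurableSet_Dset d n ε)
  have hGnn (Z : Fin k → Rd d × Rd d) : 0 ≤ G k Z :=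
    Set.indicator_nonneg (fun W _ => Finset.prod_nonneg fun i _ => hnn _) Z
  have hmp := (volume_preserving_piFinSuccAbove (fun _ : Fin (k + 1) => Rd d × Rd d) 0).symm
  let c (z : Rd d × Rd d) (Z : Fin k → Rd d × Rd d) : Fin (k + 1) → Rd d × Rd d := Fin.cons z Z
  have hcons (p : (Rd d × Rd d) × (Fin k → Rd d × Rd d)) :
      (MeasurableEquiv.piFinSuccAbove (fun _ : Fin (k + 1) => Rd d × Rd d) 0).symm p =
        c p.1 p.2 := by
    simp [c, MeasurableEquiv.piFinSuccAbove, Fin.insertNthEquiv]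
  have hGcons (z : Rd d × Rd d) (Z : Fin k → Rd d × Rd d) :
      G (k + 1) (c z Z) =
        G k Z * {z : Rd d × Rd d | ∀ i, ε < dist z.1 (Z i).1}.indicator f₀ z := by
    have hmem : c z Z ∈ Dset d (k + 1) ε ↔ _ := cons_mem_Dset_iff d k ε z Z
    have hprod : ∏ i, f₀ (c z Z i) = f₀ z * ∏ i, f₀ (Z i) := by simp [c, Fin.prod_univ_succ]
    by_cases hZ : Z ∈ Dset d k ε
    · by_cases hz : z ∈ {z : Rd d × Rd d | ∀ i, ε < dist z.1 (Z i).1}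
      · simp only [G, Set.indicator_of_mem (hmem.2 ⟨hZ, hz⟩), Set.indicator_of_mem hZ,
          Set.indicator_of_mem hz, hprod, mul_comm]
      · simp only [G, Set.indicator_of_notMem (fun hc => hz (hmem.1 hc).2),
          Set.indicator_of_notMem hz, mul_zero]
    · simp only [G, Set.indicator_of_notMem (fun hc => hZ (hmem.1 hc).1),
        Set.indicator_of_notMem hZ, zero_mul]
  have hprod : Integrable (fun p : (Rd d × Rd d) × (Fin k → Rd d × Rd d) =>
      G (k + 1) (c p.1 p.2)) ((volume : Measure (Rd d × Rd d)).prod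
        (volume : Measure (Fin k → Rd d × Rd d))) := by
    have := (hmp.integrable_comp_emb (MeasurableEquiv.measurableEmbedding _)).2 (hGint (k + 1))
    simp only [Function.comp_def, hcons] at this
    exact this
  have hinner (Z : Fin k → Rd d × Rd d) : ∫ z, G (k + 1) (c z Z) = G k Z * h Z := by
    simp only [hGcons, integral_const_mul]
    rw [integral_indicator (measurableSet_setOf_forall_lt_dist_fst d k ε Z)]
  have : SigmaFinite (volume : Measure (Rd d × Rd d)) := inferInstance
  have : SigmaFinite (volume : Measure (Fin k → Rd d × Rd d)) := inferInstance
  have hGh : Integrable fun Z => G k Z * h Z := by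
    simpa only [hinner] using hprod.integral_prod_right
  have hsucc : partitionFunction d (k + 1) ε f₀ = ∫ Z, G k Z * h Z := by
    rw [hG, ← hmp.integral_comp (MeasurableEquiv.measurableEmbedding _)]
    simp only [hcons]
    rw [Measure.volume_eq_prod, integral_prod_symm _ hprod]
    simp only [hinner]
  rw [hsucc, hG k]
  constructor
  · rw [← integral_const_mul]
    refine integral_mono ((hGint k).const_mul _) hGh fun Z => ?_
    change _ * G k Z ≤ G k Z * h Z
    rw [mul_comm]
    exact mul_le_mul_of_nonneg_left
      (one_sub_le_setIntegral_forall_lt_dist d k ε M hε f₀ hnn hint hmass hM Z) (hGnn Z)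
  · refine integral_mono hGh (hGint k) fun Z => ?_
    refine mul_le_of_le_one_right (hGnn Z) ?_
    exact (setIntegral_le_integral hint (.of_forall hnn)).trans hmass.le

theorem partitionFunction_zero (d : ℕ) (ε : ℝ) (f₀ : Rd d × Rd d → ℝ) :
    partitionFunction d 0 ε f₀ = 1 := by
  have : Dset d 0 ε = Set.univ := Set.eq_univ_of_forall fun Z i => i.elim0
  simp [partitionFunction, this, Measure.real, volume_pi]


/-- **Ratio bound for partition functions (Lemma 12.2).** In the Boltzmann–Grad scaling
`N ε^{d−1} = ℓ⁻¹`, if `ℓ⁻¹ |B_1^d| M ε < 1` then for all `1 ≤ s < N`: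
`1 ≤ 𝒵_N⁻¹ 𝒵_{N−s} ≤ (1 − ℓ⁻¹ |B_1^d| M ε)^{−s}`. -/
theorem partition_function_ratio_bound
    (d N : ℕ) (hd : 2 ≤ d) (ℓ ε M : ℝ) (hℓ : 0 < ℓ) (hε : 0 < ε)
    (hscale : (N : ℝ) * ε ^ (d - 1) = ℓ⁻¹)
    (f₀ : Rd d × Rd d → ℝ) (hmeas : Measurable f₀) (hnn : ∀ z, 0 ≤ f₀ z)
    (hint : Integrable f₀) (hmass : ∫ z, f₀ z = 1)
    (hM : ∀ᵐ x : Rd d, (∫ v : Rd d, f₀ (x, v)) ≤ M)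
    (hsmall : ℓ⁻¹ * unitBallVol d * M * ε < 1)
    (s : ℕ) (hs : 1 ≤ s) (hsN : s < N) :
    1 ≤ (partitionFunction d N ε f₀)⁻¹ * partitionFunction d (N - s) ε f₀ ∧
    (partitionFunction d N ε f₀)⁻¹ * partitionFunction d (N - s) ε f₀
      ≤ ((1 - ℓ⁻¹ * unitBallVol d * M * ε) ^ s)⁻¹ := by
  have hM0 : 0 ≤ M := by
    obtain ⟨x, hx⟩ := hM.exists
    exact (integral_nonneg fun v => hnn (x, v)).trans hx
  set a := ℓ⁻¹ * unitBallVol d * M * ε with ha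
  have hκ : 0 ≤ unitBallVol d * M * ε ^ d :=
    mul_nonneg (mul_nonneg ENNReal.toReal_nonneg hM0) (pow_nonneg hε.le d)
  have haN : a = N * (unitBallVol d * M * ε ^ d) := by
    obtain ⟨n, rfl⟩ : ∃ n, d = n + 1 := ⟨d - 1, by omega⟩
    rw [ha, ← hscale, Nat.add_sub_cancel, pow_succ]
    ring
  have hb : 0 < 1 - a := sub_pos.2 hsmall
  have hbounds (k : ℕ) :=
    partitionFunction_succ_bounds d k ε M hε f₀ hnn hint hmass hM
  have hstep (k : ℕ) (hk : k ≤ N) (hZ : 0 ≤ partitionFunction d k ε f₀) :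
      (1 - a) * partitionFunction d k ε f₀ ≤ partitionFunction d (k + 1) ε f₀ := by
    refine le_trans (mul_le_mul_of_nonneg_right ?_ hZ) (hbounds k).1
    rw [haN]
    gcongr
  have hpos (k : ℕ) (hk : k ≤ N) : 0 < partitionFunction d k ε f₀ := by
    induction k with
    | zero => rw [partitionFunction_zero]; exact one_pos
    | succ k ih =>
      have := ih (by omega)
      exact (mul_pos hb this).trans_le (hstep k (by omega) this.le)
  have hmono : partitionFunction d N ε f₀ ≤ partitionFunction d (N - s) ε f₀ :=
    antitone_nat_of_succ_le (f := fun k => partitionFunction d k ε f₀)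
      (fun k => (hbounds k).2) (Nat.sub_le N s)
  have hpow (j : ℕ) (hj : N - s + j ≤ N) :
      (1 - a) ^ j * partitionFunction d (N - s) ε f₀ ≤
        partitionFunction d (N - s + j) ε f₀ := by
    induction j with
    | zero => simp
    | succ j ih =>
      calc (1 - a) ^ (j + 1) * partitionFunction d (N - s) ε f₀
          = (1 - a) * ((1 - a) ^ j * partitionFunction d (N - s) ε f₀) := by ring
        _ ≤ (1 - a) * partitionFunction d (N - s + j) ε f₀ :=
            mul_le_mul_of_nonneg_left (ih (by omega)) hb.le
        _ ≤ _ := hstep _ (by omega) (hpos _ (by omega)).le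
  have hs' := hpow s (by omega)
  rw [Nat.sub_add_cancel hsN.le] at hs'
  have hZN := hpos N le_rfl
  rw [inv_mul_eq_div, inv_eq_one_div, one_le_div hZN, div_le_div_iff₀ hZN (pow_pos hb s)]
  exact ⟨hmono, by linarith⟩
end
end

section
/- Weighted dispersive bound for the intertwined Boltzmann hierarchy collision operator (inequality (s11-V7)). Let d ≥ 2 and s ∈ ℕ. There is a constant C_d > 0, depending only on d, such that the following holds. Let 0 < β' < β, μ' < μ, τ ≥ 0, and let g : ℝ^{2d(s+1)} → ℝ be measurable with M := sup_{Z_{s+1}} e^{μ(s+1)} e^{β[E_{s+1}(Z_{s+1}) + I_{s+1}(Z_{s+1})]} |g(Z_{s+1})| < ∞. Then sup_{Z_s ∈ ℝ^{2ds}} e^{μ' s} e^{β'[E_s(Z_s) + I_s(Z_s)]} |(V⁰_{s+1}(τ) g)(Z_s)| ≤ C_d e^{−μ} β^{−d/2} (1+τ)^{−d} ( 1/(√(β−β') √(μ−μ')) + β^{−1/2}/(μ−μ') ) · M. -/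
noncomputable section
open MeasureTheory Real
open scoped InnerProductSpace BigOperators

/-- The `s`-particle phase space `(ℝ^d × ℝ^d)^s`. -/
abbrev Phase (d s : ℕ) := Fin s → Rd d × Rd d

/-- The kinetic energy `E_s(Z_s) = (1/2)∑ |v_i|²`. -/
def energy {d s : ℕ} (Z : Phase d s) : ℝ := (1 / 2) * ∑ i, ‖(Z i).2‖ ^ 2

/-- The moment of inertia `I_s(Z_s) = (1/2)∑ |x_i|²`. -/
def inertia {d s : ℕ} (Z : Phase d s) : ℝ := (1 / 2) * ∑ i, ‖(Z i).1‖ ^ 2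

/-- The surface measure on the unit sphere of `ℝ^d`. -/
def sphMeas (d : ℕ) : Measure (Metric.sphere (0 : Rd d) 1) :=
  (volume : Measure (Rd d)).toSphere

/-- The intertwined Boltzmann hierarchy collision operator
`V⁰_{s+1}(τ) = T⁰_s(−τ) C⁰_{s+1} T⁰_{s+1}(τ)`. -/
def Vop (d s : ℕ) (τ : ℝ) (g : Phase d (s + 1) → ℝ) (Z : Phase d s) : ℝ :=
  ∑ i : Fin s,
    ∫ w : Rd d,
      ∫ ω : Metric.sphere (0 : Rd d) 1,
        (max ⟪(ω : Rd d), w - (Z i).2⟫_ℝ 0 *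
            g (Fin.snoc
                (Function.update Z i
                  ((Z i).1 - τ • (⟪(ω : Rd d), w - (Z i).2⟫_ℝ • (ω : Rd d)),
                    (Z i).2 + ⟪(ω : Rd d), w - (Z i).2⟫_ℝ • (ω : Rd d)))
                ((Z i).1 - τ • (w - ⟪(ω : Rd d), w - (Z i).2⟫_ℝ • (ω : Rd d) - (Z i).2),
                  w - ⟪(ω : Rd d), w - (Z i).2⟫_ℝ • (ω : Rd d)))
          - max (-⟪(ω : Rd d), w - (Z i).2⟫_ℝ) 0 *
              g (Fin.snoc Z ((Z i).1 - τ • (w - (Z i).2), w))) ∂(sphMeas d)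

section WeightedBound

variable {d s : ℕ}

/-- The total weight of the phase point obtained by appending one particle. -/
theorem energy_add_inertia_snoc (Z : Phase d s) (p : Rd d × Rd d) :
    energy (Fin.snoc Z p : Phase d (s + 1)) + inertia (Fin.snoc Z p : Phase d (s + 1))
      = energy Z + inertia Z + (1 / 2) * (‖p.2‖ ^ 2 + ‖p.1‖ ^ 2) := by
  simp only [energy, inertia, Fin.sum_univ_castSucc, Fin.snoc_castSucc, Fin.snoc_last]
  ring

theorem energy_add_inertia_update (Z : Phase d s) (i : Fin s) (p : Rd d × Rd d) :
    energy (Function.update Z i p) + inertia (Function.update Z i p)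
      = energy Z + inertia Z
        + (1 / 2) * (‖p.2‖ ^ 2 + ‖p.1‖ ^ 2 - ‖(Z i).2‖ ^ 2 - ‖(Z i).1‖ ^ 2) := by
  have key : ∀ φ : Rd d × Rd d → ℝ,
      ∑ j, φ (Function.update Z i p j) = ∑ j, φ (Z j) + (φ p - φ (Z i)) := by
    intro φ
    rw [← Finset.add_sum_erase _ _ (Finset.mem_univ i),
      ← Finset.add_sum_erase _ (fun j => φ (Z j)) (Finset.mem_univ i)]
    have : ∑ j ∈ Finset.univ.erase i, φ (Function.update Z i p j)
        = ∑ j ∈ Finset.univ.erase i, φ (Z j) :=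
      Finset.sum_congr rfl fun j hj => by
        rw [Function.update_of_ne (Finset.ne_of_mem_erase hj)]
    rw [this, Function.update_self]
    ring
  have h₁ := key fun q => ‖q.1‖ ^ 2
  have h₂ := key fun q => ‖q.2‖ ^ 2
  simp only [energy, inertia, h₁, h₂]
  ring

/-- The collision transform conserves kinetic energy and moment of inertia. -/
theorem collision_weight_conserved (x v w ω : Rd d) (τ : ℝ) (hω : ‖ω‖ = 1) :
    ‖v + ⟪ω, w - v⟫_ℝ • ω‖ ^ 2 + ‖x - τ • (⟪ω, w - v⟫_ℝ • ω)‖ ^ 2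
        + ‖w - ⟪ω, w - v⟫_ℝ • ω‖ ^ 2 + ‖x - τ • (w - ⟪ω, w - v⟫_ℝ • ω - v)‖ ^ 2
      = ‖v‖ ^ 2 + ‖x‖ ^ 2 + ‖w‖ ^ 2 + ‖x - τ • (w - v)‖ ^ 2 := by
  have hωω : ⟪ω, ω⟫_ℝ = 1 := by rw [real_inner_self_eq_norm_sq, hω]; norm_num
  simp only [← real_inner_self_eq_norm_sq, inner_add_left, inner_add_right, inner_sub_left,
    inner_sub_right, inner_smul_left, inner_smul_right, conj_trivial, hωω]
  rw [real_inner_comm ω v, real_inner_comm ω w, real_inner_comm ω x, real_inner_comm w v,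
    real_inner_comm x v, real_inner_comm x w]
  ring

/-- Completing the square in the dispersive weight. -/
theorem norm_sq_add_norm_sub_smul_sq_ge (x v w : Rd d) (τ : ℝ) :
    (1 + τ ^ 2) * ‖w - (τ / (1 + τ ^ 2)) • (x + τ • v)‖ ^ 2
      ≤ ‖w‖ ^ 2 + ‖x - τ • (w - v)‖ ^ 2 := by
  have h : x - τ • (w - v) = (x + τ • v) - τ • w := by module
  rw [h]
  generalize x + τ • v = y
  have hp : 0 < 1 + τ ^ 2 := by positivity
  have hy : 0 ≤ ‖y‖ ^ 2 / (1 + τ ^ 2) := by positivity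
  have e : ‖w‖ ^ 2 + ‖y - τ • w‖ ^ 2
      = (1 + τ ^ 2) * ‖w - (τ / (1 + τ ^ 2)) • y‖ ^ 2 + ‖y‖ ^ 2 / (1 + τ ^ 2) := by
    simp only [norm_sub_sq_real, inner_smul_right, norm_smul, mul_pow,
      Real.norm_eq_abs, sq_abs, real_inner_comm w y]
    field_simp
    ring
  linarith

theorem mul_exp_neg_mul_sq_le {β : ℝ} (hβ : 0 < β) (t : ℝ) :
    t * exp (-(β / 4) * t ^ 2) ≤ β ^ (-(1 : ℝ) / 2) := by
  have hs : β ^ (-(1 : ℝ) / 2) = (√β)⁻¹ := by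
    rw [Real.sqrt_eq_rpow, ← Real.rpow_neg hβ.le]; norm_num
  have hq : 0 < √β := Real.sqrt_pos.2 hβ
  have h1 : √β * t ≤ exp (β / 4 * t ^ 2) := by
    have h2 := Real.add_one_le_exp (β / 4 * t ^ 2)
    have h3 : √β ^ 2 = β := Real.sq_sqrt hβ.le
    nlinarith [sq_nonneg (1 - √β * t / 2)]
  rw [hs, neg_mul, Real.exp_neg, ← div_eq_mul_inv, div_le_iff₀ (Real.exp_pos _),
    inv_mul_eq_div, le_div_iff₀ hq]
  linarith

theorem integral_exp_neg_mul_norm_sub_sq {b : ℝ} (hb : 0 < b) (c : Rd d) :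
    ∫ w : Rd d, exp (-b * ‖w - c‖ ^ 2) = (π / b) ^ ((d : ℝ) / 2) := by
  rw [integral_sub_right_eq_self (fun w : Rd d => exp (-b * ‖w‖ ^ 2)) c,
    GaussianFourier.integral_rexp_neg_mul_sq_norm hb]
  simp

theorem integrable_exp_neg_mul_norm_sub_sq {b : ℝ} (hb : 0 < b) (c : Rd d) :
    Integrable fun w : Rd d => exp (-b * ‖w - c‖ ^ 2) := by
  apply Integrable.of_integral_ne_zero
  rw [integral_exp_neg_mul_norm_sub_sq hb]
  positivity

theorem gaussian_mass_le {β τ : ℝ} (hβ : 0 < β) (hτ : 0 ≤ τ) :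
    (π / (β / 4 * (1 + τ ^ 2))) ^ ((d : ℝ) / 2)
      ≤ (8 * π) ^ ((d : ℝ) / 2) * β ^ (-(d : ℝ) / 2) * (1 + τ) ^ (-(d : ℝ)) := by
  have hπ := Real.pi_pos
  have h1 : (1 + τ) ^ (-(d : ℝ)) = (((1 + τ) ^ 2)⁻¹) ^ ((d : ℝ) / 2) := by
    rw [Real.inv_rpow (by positivity), ← Real.rpow_natCast, ← Real.rpow_mul (by positivity),
      ← Real.rpow_neg (by positivity)]
    congr 1
    push_cast
    ring
  have h2 : β ^ (-(d : ℝ) / 2) = (β⁻¹) ^ ((d : ℝ) / 2) := by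
    rw [Real.inv_rpow hβ.le, ← Real.rpow_neg hβ.le, neg_div]
  rw [h1, h2, ← Real.mul_rpow (by positivity) (by positivity),
    ← Real.mul_rpow (by positivity) (by positivity)]
  apply Real.rpow_le_rpow (by positivity) _ (by positivity)
  rw [← div_eq_mul_inv, ← div_eq_mul_inv, div_div,
    div_le_div_iff₀ (by positivity) (by positivity)]
  have : (1 + τ) ^ 2 ≤ 2 * (1 + τ ^ 2) := by nlinarith [sq_nonneg (1 - τ)]
  have hm := mul_le_mul_of_nonneg_left this (mul_pos hπ hβ).le
  nlinarith

/-- Pointwise bound on the collision integrand. -/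
theorem abs_collision_integrand_le {β μ τ M : ℝ} {g : Phase d (s + 1) → ℝ}
    (hg : ∀ W : Phase d (s + 1),
      exp (μ * ((s : ℝ) + 1)) * exp (β * (energy W + inertia W)) * |g W| ≤ M)
    (Z : Phase d s) (i : Fin s) (w ω : Rd d) (hω : ‖ω‖ = 1) :
    |max ⟪ω, w - (Z i).2⟫_ℝ 0 *
            g (Fin.snoc
                (Function.update Z i
                  ((Z i).1 - τ • (⟪ω, w - (Z i).2⟫_ℝ • ω),
                    (Z i).2 + ⟪ω, w - (Z i).2⟫_ℝ • ω))
                ((Z i).1 - τ • (w - ⟪ω, w - (Z i).2⟫_ℝ • ω - (Z i).2),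
                  w - ⟪ω, w - (Z i).2⟫_ℝ • ω))
          - max (-⟪ω, w - (Z i).2⟫_ℝ) 0 *
              g (Fin.snoc Z ((Z i).1 - τ • (w - (Z i).2), w))|
      ≤ M * exp (-(μ * ((s : ℝ) + 1))) * exp (-(β * (energy Z + inertia Z))) *
          (‖w - (Z i).2‖ *
            exp (-(β / 2) * (‖w‖ ^ 2 + ‖(Z i).1 - τ • (w - (Z i).2)‖ ^ 2))) := by
  set Q := ‖w‖ ^ 2 + ‖(Z i).1 - τ • (w - (Z i).2)‖ ^ 2 with hQ
  set B := M * exp (-(μ * ((s : ℝ) + 1))) * exp (-(β * (energy Z + inertia Z))) *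
    exp (-(β / 2) * Q) with hB
  have bound : ∀ W : Phase d (s + 1),
      energy W + inertia W = energy Z + inertia Z + (1 / 2) * Q → |g W| ≤ B := by
    intro W hW
    have h := hg W
    rw [hW, mul_comm, ← Real.exp_add, ← le_div_iff₀ (Real.exp_pos _), div_eq_mul_inv,
      ← Real.exp_neg] at h
    refine h.trans_eq ?_
    rw [hB, mul_assoc, mul_assoc, ← Real.exp_add, ← Real.exp_add]
    congr 2
    ring
  have hgain := bound _ ((energy_add_inertia_snoc (Function.update Z i
      ((Z i).1 - τ • (⟪ω, w - (Z i).2⟫_ℝ • ω), (Z i).2 + ⟪ω, w - (Z i).2⟫_ℝ • ω))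
      ((Z i).1 - τ • (w - ⟪ω, w - (Z i).2⟫_ℝ • ω - (Z i).2),
        w - ⟪ω, w - (Z i).2⟫_ℝ • ω)).trans (by
    rw [energy_add_inertia_update]
    have := collision_weight_conserved (Z i).1 (Z i).2 w ω τ hω
    simp only
    linarith))
  have hloss := bound _ (energy_add_inertia_snoc Z ((Z i).1 - τ • (w - (Z i).2), w))
  have hB0 : 0 ≤ B := (abs_nonneg _).trans hloss
  have hin : |⟪ω, w - (Z i).2⟫_ℝ| ≤ ‖w - (Z i).2‖ := by
    simpa [hω] using abs_real_inner_le_norm ω (w - (Z i).2)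
  generalize ⟪ω, w - (Z i).2⟫_ℝ = a at *
  have hsum : max a 0 + max (-a) 0 = |a| := by
    rcases le_total 0 a with h | h
    · rw [max_eq_left h, max_eq_right (by linarith), abs_of_nonneg h, add_zero]
    · rw [max_eq_right h, max_eq_left (by linarith), abs_of_nonpos h, zero_add]
  refine (abs_sub _ _).trans ?_
  rw [abs_mul, abs_mul, abs_of_nonneg (le_max_right a 0), abs_of_nonneg (le_max_right (-a) 0)]
  calc _ ≤ max a 0 * B + max (-a) 0 * B :=
        add_le_add (mul_le_mul_of_nonneg_left hgain (le_max_right _ _))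
          (mul_le_mul_of_nonneg_left hloss (le_max_right _ _))
    _ = |a| * B := by rw [← hsum]; ring
    _ ≤ ‖w - (Z i).2‖ * B := mul_le_mul_of_nonneg_right hin hB0
    _ = _ := by rw [hB]; ring

/-- Absorbing the relative speed into half of the Gaussian weight. -/
theorem relative_speed_mul_weight_le {β : ℝ} (hβ : 0 < β) (x v w : Rd d) (τ : ℝ) :
    ‖w - v‖ * exp (-(β / 2) * (‖w‖ ^ 2 + ‖x - τ • (w - v)‖ ^ 2))
      ≤ (‖v‖ + β ^ (-(1 : ℝ) / 2)) *
        exp (-(β / 4 * (1 + τ ^ 2)) * ‖w - (τ / (1 + τ ^ 2)) • (x + τ • v)‖ ^ 2) := by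
  have hsq := norm_sq_add_norm_sub_smul_sq_ge x v w τ
  set Q := ‖w‖ ^ 2 + ‖x - τ • (w - v)‖ ^ 2 with hQ
  have hwQ : ‖w‖ ^ 2 ≤ Q := le_add_of_nonneg_right (by positivity)
  have hsplit : exp (-(β / 2) * Q) = exp (-(β / 4) * Q) * exp (-(β / 4) * Q) := by
    rw [← Real.exp_add]; congr 1; ring
  have hw : exp (-(β / 4) * Q) ≤ exp (-(β / 4) * ‖w‖ ^ 2) := by
    apply Real.exp_le_exp.2; nlinarith
  have h1 : exp (-(β / 4) * Q) ≤ 1 := by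
    apply Real.exp_le_one_iff.2
    have : 0 ≤ Q := by positivity
    nlinarith
  have hG : exp (-(β / 4) * Q) ≤
      exp (-(β / 4 * (1 + τ ^ 2)) * ‖w - (τ / (1 + τ ^ 2)) • (x + τ • v)‖ ^ 2) := by
    apply Real.exp_le_exp.2; nlinarith
  have hm := mul_exp_neg_mul_sq_le hβ ‖w‖
  have hspeed : ‖w - v‖ * exp (-(β / 4) * Q) ≤ ‖v‖ + β ^ (-(1 : ℝ) / 2) := by
    calc ‖w - v‖ * exp (-(β / 4) * Q) ≤ (‖w‖ + ‖v‖) * exp (-(β / 4) * Q) :=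
          mul_le_mul_of_nonneg_right (norm_sub_le _ _) (Real.exp_pos _).le
      _ = ‖v‖ * exp (-(β / 4) * Q) + ‖w‖ * exp (-(β / 4) * Q) := by ring
      _ ≤ ‖v‖ * 1 + ‖w‖ * exp (-(β / 4) * ‖w‖ ^ 2) := by gcongr
      _ ≤ _ := by linarith
  rw [hsplit, ← mul_assoc]
  exact mul_le_mul hspeed hG (Real.exp_pos _).le (by positivity)

instance : IsFiniteMeasure (sphMeas d) := by
  unfold sphMeas; infer_instance

theorem abs_Vop_le {β μ τ M : ℝ} {g : Phase d (s + 1) → ℝ} (hβ : 0 < β) (hτ : 0 ≤ τ)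
    (hM : 0 ≤ M)
    (hg : ∀ W : Phase d (s + 1),
      exp (μ * ((s : ℝ) + 1)) * exp (β * (energy W + inertia W)) * |g W| ≤ M)
    (Z : Phase d s) :
    |Vop d s τ g Z| ≤
      M * exp (-(μ * ((s : ℝ) + 1))) * exp (-(β * (energy Z + inertia Z))) *
        (sphMeas d).real Set.univ *
        ((8 * π) ^ ((d : ℝ) / 2) * β ^ (-(d : ℝ) / 2) * (1 + τ) ^ (-(d : ℝ))) *
        ∑ i, (‖(Z i).2‖ + β ^ (-(1 : ℝ) / 2)) := by
  set A := M * exp (-(μ * ((s : ℝ) + 1))) * exp (-(β * (energy Z + inertia Z))) with hA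
  have hA0 : 0 ≤ A := by positivity
  set K := (sphMeas d).real Set.univ with hK
  have hK0 : 0 ≤ K := measureReal_nonneg
  have hb : 0 < β / 4 * (1 + τ ^ 2) := by positivity
  rw [Vop, Finset.mul_sum]
  refine (Finset.abs_sum_le_sum_abs _ _).trans (Finset.sum_le_sum fun i _ => ?_)
  set c := (τ / (1 + τ ^ 2)) • ((Z i).1 + τ • (Z i).2) with hc
  set D := A * (‖(Z i).2‖ + β ^ (-(1 : ℝ) / 2)) * K with hD
  have hD0 : 0 ≤ D := by positivity
  calc _ ≤ ∫ w : Rd d, D * exp (-(β / 4 * (1 + τ ^ 2)) * ‖w - c‖ ^ 2) := by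
        rw [← Real.norm_eq_abs]
        refine norm_integral_le_of_norm_le
          ((integrable_exp_neg_mul_norm_sub_sq hb c).const_mul D)
          (Filter.Eventually.of_forall fun w => ?_)
        refine (norm_integral_le_of_norm_le_const (μ := sphMeas d)
          (Filter.Eventually.of_forall fun (ω : Metric.sphere (0 : Rd d) 1) =>
            (abs_collision_integrand_le hg Z i w (ω : Rd d)
              (mem_sphere_zero_iff_norm.1 ω.2)).trans
              (mul_le_mul_of_nonneg_left
                (relative_speed_mul_weight_le hβ (Z i).1 (Z i).2 w τ) hA0))).trans_eq ?_
        rw [hD, hc, hK]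
        ring
    _ = D * (π / (β / 4 * (1 + τ ^ 2))) ^ ((d : ℝ) / 2) := by
        rw [integral_const_mul, integral_exp_neg_mul_norm_sub_sq hb]
    _ ≤ D * ((8 * π) ^ ((d : ℝ) / 2) * β ^ (-(d : ℝ) / 2) * (1 + τ) ^ (-(d : ℝ))) :=
        mul_le_mul_of_nonneg_left (gaussian_mass_le hβ hτ) hD0
    _ = _ := by rw [hD]; ring

theorem sum_norm_velocity_le (Z : Phase d s) :
    ∑ i, ‖(Z i).2‖ ≤ 2 * (√s * √(energy Z)) := by
  have h := sq_sum_le_card_mul_sum_sq (s := Finset.univ) (f := fun i => ‖(Z i).2‖)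
  have hE : ∑ i, ‖(Z i).2‖ ^ 2 = 2 * energy Z := by rw [energy]; ring
  have hE0 : 0 ≤ energy Z := by unfold energy; positivity
  rw [hE, Finset.card_univ, Fintype.card_fin] at h
  refine abs_le_of_sq_le_sq' ?_ (by positivity) |>.2
  rw [mul_pow, mul_pow, Real.sq_sqrt (Nat.cast_nonneg s), Real.sq_sqrt hE0]
  nlinarith [mul_nonneg (Nat.cast_nonneg (α := ℝ) s) hE0]

theorem mul_exp_neg_mul_le_inv {a : ℝ} (ha : 0 < a) (t : ℝ) :
    t * exp (-(a * t)) ≤ 1 / a := by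
  rw [Real.exp_neg, ← div_eq_mul_inv, div_le_div_iff₀ (Real.exp_pos _) ha]
  linarith [Real.add_one_le_exp (a * t)]

theorem sqrt_mul_exp_neg_mul_le {a t : ℝ} (ha : 0 < a) (ht : 0 ≤ t) :
    √t * exp (-(a * t)) ≤ 1 / √a := by
  rw [Real.exp_neg, ← div_eq_mul_inv,
    div_le_div_iff₀ (Real.exp_pos _) (Real.sqrt_pos.2 ha), ← Real.sqrt_mul ht, one_mul]
  refine Real.sqrt_le_iff.2 ⟨(Real.exp_pos _).le, ?_⟩
  nlinarith [Real.add_one_le_exp (a * t), mul_nonneg ha.le ht]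

/-- Loss of weight controls the sum over collision partners. -/
theorem exp_weight_mul_sum_le {a b c : ℝ} (ha : 0 < a) (hb : 0 < b) (hc : 0 ≤ c)
    (Z : Phase d s) :
    exp (-(b * s)) * exp (-(a * (energy Z + inertia Z))) * ∑ i, (‖(Z i).2‖ + c)
      ≤ 2 * (1 / (√a * √b) + c / b) := by
  have hE0 : 0 ≤ energy Z := by unfold energy; positivity
  have hI0 : 0 ≤ inertia Z := by unfold inertia; positivity
  have hs : (0 : ℝ) ≤ s := Nat.cast_nonneg s
  have hsum : ∑ i, (‖(Z i).2‖ + c) ≤ 2 * (√s * √(energy Z)) + s * c := by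
    rw [Finset.sum_add_distrib]
    simpa using sum_norm_velocity_le Z
  have hEI : exp (-(a * (energy Z + inertia Z))) ≤ exp (-(a * energy Z)) := by
    apply Real.exp_le_exp.2; nlinarith
  have hE1 : exp (-(a * energy Z)) ≤ 1 := by
    apply Real.exp_le_one_iff.2; nlinarith
  calc _ ≤ exp (-(b * s)) * exp (-(a * energy Z)) * (2 * (√s * √(energy Z)) + s * c) := by
        gcongr
    _ = 2 * ((√(energy Z) * exp (-(a * energy Z))) * (√s * exp (-(b * s))))
          + (s * exp (-(b * s))) * c * exp (-(a * energy Z)) := by ring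
    _ ≤ 2 * ((1 / √a) * (1 / √b)) + (1 / b) * c * 1 := by
        gcongr
        · exact sqrt_mul_exp_neg_mul_le ha hE0
        · exact sqrt_mul_exp_neg_mul_le hb hs
        · exact mul_exp_neg_mul_le_inv hb s
    _ = 2 * (1 / (√a * √b)) + c / b := by rw [one_div_mul_one_div]; ring
    _ ≤ _ := by
        have : 0 ≤ c / b := by positivity
        linarith

end WeightedBound

/-- **Weighted dispersive bound for the intertwined Boltzmann hierarchy collision
operator (inequality (s11-V7)).** There is `C_d > 0` depending only on `d ≥ 2` such
that for all `s`, `0 < β' < β`, `μ' < μ`, `τ ≥ 0`, and all measurable `g` with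
`e^{μ(s+1)} e^{β[E_{s+1}+I_{s+1}]} |g| ≤ M`, one has
`e^{μ' s} e^{β'[E_s+I_s]} |V⁰_{s+1}(τ) g| ≤
  C_d e^{−μ} β^{−d/2} (1+τ)^{−d} (1/(√(β−β')√(μ−μ')) + β^{−1/2}/(μ−μ')) M`. -/
theorem weighted_dispersive_bound_intertwined_collision_operator
    (d : ℕ) (hd : 2 ≤ d) :
    ∃ C : ℝ, 0 < C ∧
      ∀ (s : ℕ) (β β' μ μ' τ M : ℝ) (g : Phase d (s + 1) → ℝ),
        0 < β' → β' < β → μ' < μ → 0 ≤ τ → Measurable g →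
        (∀ W : Phase d (s + 1),
          exp (μ * ((s : ℝ) + 1)) * exp (β * (energy W + inertia W)) * |g W| ≤ M) →
        ∀ Z : Phase d s,
          exp (μ' * s) * exp (β' * (energy Z + inertia Z)) * |Vop d s τ g Z|
            ≤ C * exp (-μ) * β ^ (-(d : ℝ) / 2) * (1 + τ) ^ (-(d : ℝ)) *
                (1 / (Real.sqrt (β - β') * Real.sqrt (μ - μ'))
                  + β ^ (-(1 : ℝ) / 2) / (μ - μ')) * M := by
  refine ⟨2 * ((sphMeas d).real Set.univ + 1) * (8 * π) ^ ((d : ℝ) / 2), ?_, ?_⟩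
  · have : 0 ≤ (sphMeas d).real Set.univ := measureReal_nonneg
    have := Real.pi_pos
    positivity
  intro s β β' μ μ' τ M g hβ' hββ' hμ hτ _ hg Z
  have hβ : 0 < β := hβ'.trans hββ'
  have hM : 0 ≤ M := le_trans (by positivity) (hg 0)
  have hV := abs_Vop_le hβ hτ hM hg Z
  have hS := exp_weight_mul_sum_le (sub_pos.2 hββ') (sub_pos.2 hμ)
    (Real.rpow_nonneg hβ.le (-(1 : ℝ) / 2)) Z
  have hK0 : 0 ≤ (sphMeas d).real Set.univ := measureReal_nonneg
  set K := (sphMeas d).real Set.univ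
  set G := (8 * π) ^ ((d : ℝ) / 2) * β ^ (-(d : ℝ) / 2) * (1 + τ) ^ (-(d : ℝ)) with hG
  have hG0 : 0 ≤ G := by positivity
  set R := 1 / (√(β - β') * √(μ - μ')) + β ^ (-(1 : ℝ) / 2) / (μ - μ')
  have hR0 : 0 ≤ R := by
    have := sub_pos.2 hμ
    positivity
  set S := ∑ i, (‖(Z i).2‖ + β ^ (-(1 : ℝ) / 2))
  have hexp : exp (μ' * s) * exp (β' * (energy Z + inertia Z)) *
      (exp (-(μ * ((s : ℝ) + 1))) * exp (-(β * (energy Z + inertia Z))))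
      = exp (-μ) *
        (exp (-((μ - μ') * s)) * exp (-((β - β') * (energy Z + inertia Z)))) := by
    simp only [← Real.exp_add]
    congr 1
    ring
  calc _ ≤ exp (μ' * s) * exp (β' * (energy Z + inertia Z)) *
        (M * exp (-(μ * ((s : ℝ) + 1))) * exp (-(β * (energy Z + inertia Z))) * K * G * S) := by
        gcongr
    _ = M * K * G * S * (exp (μ' * s) * exp (β' * (energy Z + inertia Z)) *
          (exp (-(μ * ((s : ℝ) + 1))) * exp (-(β * (energy Z + inertia Z))))) := by ring
    _ = M * K * G * exp (-μ) *
          (exp (-((μ - μ') * s)) * exp (-((β - β') * (energy Z + inertia Z))) * S) := by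
        rw [hexp]; ring
    _ ≤ M * (K + 1) * G * exp (-μ) * (2 * R) := by
        gcongr
        linarith
    _ = _ := by rw [hG]; ring
end
end
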